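/- For any two elements g, h of the set {(1 2 3), (1 3 2), (4 5 6), (4 6 5)} there exist an integer k coprime to 3 and an element w ∈ G with w·g^k·w⁻¹ = h; that is, the four index-2 elements of G form a single ℚ-conjugacy class. -/

import Mathlib

/-- The 3-cycle (1 2 3) of S₆, acting on `Fin 6` as the cycle 0 → 1 → 2 → 0. -/
def g₁ : Equiv.Perm (Fin 6) := List.formPerm [0, 1, 2]

/-- The 3-cycle (1 3 2) of S₆. -/
def g₁' : Equiv.Perm (Fin 6) := List.formPerm [0, 2, 1]

/-- The 3-cycle (4 5 6) of S₆, acting on `Fin 6` as the cycle 3 → 4 → 5 → 3. -/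
def g₂ : Equiv.Perm (Fin 6) := List.formPerm [3, 4, 5]

/-- The 3-cycle (4 6 5) of S₆. -/
def g₂' : Equiv.Perm (Fin 6) := List.formPerm [3, 5, 4]

/-- The involution (1 4)(2 5)(3 6) of S₆. -/
def g₃ : Equiv.Perm (Fin 6) :=
  Equiv.swap 0 3 * Equiv.swap 1 4 * Equiv.swap 2 5

/-- Klüners' group `G = C₃ ≀ C₂ ≤ S₆`, generated by (1 2 3), (4 5 6) and
(1 4)(2 5)(3 6). -/
def G : Subgroup (Equiv.Perm (Fin 6)) := Subgroup.closure {g₁, g₂, g₃}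

theorem g₃_mem_G : g₃ ∈ G :=
  Subgroup.subset_closure (by simp)

theorem g₁'_eq_inv : g₁' = g₁⁻¹ := by decide

theorem g₂'_eq_inv : g₂' = g₂⁻¹ := by decide

theorem g₃_conj_g₁ : g₃ * g₁ * g₃⁻¹ = g₂ := by decide

/-- Each listed element is a `G`-conjugate of `g₁` or `g₁⁻¹`. -/
theorem exists_conj_g₁_zpow_unit {g : Equiv.Perm (Fin 6)}
    (hg : g ∈ ({g₁, g₁', g₂, g₂'} : Set (Equiv.Perm (Fin 6)))) :
    ∃ u : ℤˣ, ∃ w ∈ G, w * g₁ ^ (u : ℤ) * w⁻¹ = g := by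
  rcases hg with rfl | rfl | rfl | rfl
  · exact ⟨1, 1, G.one_mem, by simp⟩
  · exact ⟨-1, 1, G.one_mem, by simp [g₁'_eq_inv]⟩
  · exact ⟨1, g₃, g₃_mem_G, by simp [g₃_conj_g₁]⟩
  · exact ⟨-1, g₃, g₃_mem_G, by simp [g₂'_eq_inv, ← g₃_conj_g₁, mul_assoc]⟩

/-- The four index-2 elements (1 2 3), (1 3 2), (4 5 6), (4 6 5) of Klüners'
group form a single ℚ-conjugacy class: for any two of them, say g and h,
there are an integer k coprime to 3 and an element w of G with
w · gᵏ · w⁻¹ = h. -/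
theorem index_two_elements_one_rational_conjugacy_class :
    ∀ g ∈ ({g₁, g₁', g₂, g₂'} : Set (Equiv.Perm (Fin 6))),
      ∀ h ∈ ({g₁, g₁', g₂, g₂'} : Set (Equiv.Perm (Fin 6))),
        ∃ k : ℤ, IsCoprime k 3 ∧ ∃ w ∈ G, w * g ^ k * w⁻¹ = h := by
  intro g hg h hh
  obtain ⟨u, w, hw, rfl⟩ := exists_conj_g₁_zpow_unit hg
  obtain ⟨v, x, hx, rfl⟩ := exists_conj_g₁_zpow_unit hh
  refine ⟨(u * v : ℤˣ), ⟨(u * v : ℤˣ), 0, by simp [← Units.val_mul, Int.units_mul_self]⟩, x * w⁻¹, G.mul_mem hx (G.inv_mem hw), ?_⟩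
  have huv : (u : ℤ) * (u * v : ℤˣ) = v := by
    rw [← Units.val_mul, ← mul_assoc, Int.units_mul_self, one_mul]
  rw [conj_zpow, ← zpow_mul, huv]
  group
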